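/- Let r ≥ 2 and let F be the free group of rank r. The set of elements w ∈ F of length at least 5 such that the middle third of the reduced word of w occurs as a contiguous sublist of the reduced word of the cyclic reduction of w is exponentially generic in F. -/

import Mathlib

namespace VG

variable {r : ℕ}

/-- Word length: the length of the unique freely reduced word representing `w`. -/
def len (w : FreeGroup (Fin r)) : ℕ := (FreeGroup.toWord w).length

/-- The number of elements of `A` of word length at most `n`. -/
noncomputable def ballCount (A : Set (FreeGroup (Fin r))) (n : ℕ) : ℕ :=
  {w | w ∈ A ∧ len w ≤ n}.ncard

/-- The number of elements of `A` of word length exactly `n`. -/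
noncomputable def sphereCount (A : Set (FreeGroup (Fin r))) (n : ℕ) : ℕ :=
  {w | w ∈ A ∧ len w = n}.ncard

/-- `A` is exponentially generic in `B`: there are `a > 0` and `b` such that, for all
sufficiently large `n`, the proportion of elements of `B` of length at most `n` lying
in `A` is at least `1 - exp (b - a n)`. -/
def ExpGeneric (A B : Set (FreeGroup (Fin r))) : Prop :=
  ∃ a : ℝ, 0 < a ∧ ∃ b : ℝ, ∃ N : ℕ, ∀ n : ℕ, N ≤ n →
    (1 : ℝ) - Real.exp (b - a * n) ≤ (ballCount A n : ℝ) / (ballCount B n)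

/-- `A` is exponentially rare in `B` if its complement in `B` is exponentially generic. -/
def ExpRare (A B : Set (FreeGroup (Fin r))) : Prop := ExpGeneric (B \ A) B

/-- `v` is a subword of `w`: the reduced word of `v` is a contiguous sublist of that of `w`. -/
def Subword (v w : FreeGroup (Fin r)) : Prop :=
  FreeGroup.toWord v <:+: FreeGroup.toWord w

/-- `w` is cyclically reduced: the first letter of its reduced word is not the inverse of
the last letter. -/
def CyclicallyReduced (w : FreeGroup (Fin r)) : Prop :=
  ∀ a ∈ (FreeGroup.toWord w).head?, ∀ b ∈ (FreeGroup.toWord w).getLast?,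
    a ≠ (b.1, !b.2)

/-- `c` is the cyclic reduction of `w`: it is cyclically reduced and conjugate to `w`. -/
def IsCyclicReduction (c w : FreeGroup (Fin r)) : Prop :=
  CyclicallyReduced c ∧ ∃ g : FreeGroup (Fin r), w = g * c * g⁻¹

/-- Middle third of a list: delete the first and last `⌈l/3⌉` entries. -/
def middleThird {α : Type*} (l : List α) : List α :=
  (l.drop ((l.length + 2) / 3)).take (l.length - 2 * ((l.length + 2) / 3))

/-- `v` is cyclically contained in `w` if the reduced word of `v` is a subword of some
positive power of the cyclic reduction of `w`. -/
def CyclicallyContains (w v : FreeGroup (Fin r)) : Prop :=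
  ∃ c : FreeGroup (Fin r), IsCyclicReduction c w ∧ ∃ k : ℕ, 1 ≤ k ∧ Subword v (c ^ k)

/-- `w` is full: every freely reduced word of length 3, or its inverse, is cyclically
contained in `w`. -/
def Full (w : FreeGroup (Fin r)) : Prop :=
  ∀ t : FreeGroup (Fin r), len t = 3 → CyclicallyContains w t ∨ CyclicallyContains w t⁻¹

/-- The group element corresponding to a single letter. -/
def letterElem (a : Fin r × Bool) : FreeGroup (Fin r) := FreeGroup.mk [a]

/-- The inverse of a letter. -/
def linv (a : Fin r × Bool) : Fin r × Bool := (a.1, !a.2)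

/-- `w` is a proper power: `w = u^k` for some `k ≥ 2`. -/
def ProperPower (w : FreeGroup (Fin r)) : Prop :=
  ∃ u : FreeGroup (Fin r), ∃ k : ℕ, 2 ≤ k ∧ w = u ^ k

/-- Minimal word length in the conjugacy class of `w`. -/
noncomputable def conjMinLen (w : FreeGroup (Fin r)) : ℕ :=
  sInf (len '' {u | IsConj u w})

/-- `w` is Whitehead minimal: for every automorphism `α` of the free group, the length of
`w` is at most the minimal length of an element conjugate to `α w`. -/
def WhiteheadMinimal (w : FreeGroup (Fin r)) : Prop :=
  ∀ α : FreeGroup (Fin r) ≃* FreeGroup (Fin r), len w ≤ conjMinLen (α w)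


theorem finite_ball (n : ℕ) : {w : FreeGroup (Fin r) | len w ≤ n}.Finite := by
  have h := List.finite_length_le (Fin r × Bool) n
  exact (h.preimage (f := FreeGroup.toWord) FreeGroup.toWord_injective.injOn)

theorem ballCount_univ (n : ℕ) :
    ballCount (Set.univ : Set (FreeGroup (Fin r))) n
      = {w : FreeGroup (Fin r) | len w ≤ n}.ncard := by
  simp [ballCount]

theorem toWord_mk_of_reduced {L : List (Fin r × Bool)} (h : FreeGroup.IsReduced L) :
    (FreeGroup.mk L).toWord = L := by
  rw [FreeGroup.toWord_mk, h.reduce_eq]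

/-- Every reduced word has an extension letter, with either sign. -/
theorem exists_ext (hr : 2 ≤ r) (w : FreeGroup (Fin r)) :
    ∃ j : Fin r, ∀ s : Bool, FreeGroup.IsReduced (w.toWord ++ [(j, s)]) := by
  have : Nontrivial (Fin r) := Fin.nontrivial_iff_two_le.mpr hr
  rcases List.eq_nil_or_concat w.toWord with h | ⟨L, x, h⟩
  · refine ⟨⟨0, by omega⟩, fun s => ?_⟩
    rw [h]; simp
  · obtain ⟨j, hj⟩ := exists_ne x.1
    refine ⟨j, fun s => ?_⟩
    have hw : FreeGroup.IsReduced w.toWord := FreeGroup.isReduced_toWord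
    unfold FreeGroup.IsReduced at *
    rw [List.isChain_append]
    refine ⟨hw, List.isChain_singleton _, ?_⟩
    intro a ha b hb hab
    rw [h] at ha
    simp at ha hb
    subst ha hb
    exact absurd hab.symm hj

theorem two_mul_ball (hr : 2 ≤ r) (m : ℕ) :
    2 * {w : FreeGroup (Fin r) | len w ≤ m}.ncard
      ≤ {w : FreeGroup (Fin r) | len w ≤ m + 1}.ncard := by
  choose e he using exists_ext (r := r) hr
  have key := Set.ncard_le_ncard_of_injOn
    (s := (Set.univ : Set Bool) ×ˢ {w : FreeGroup (Fin r) | len w ≤ m})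
    (t := {w : FreeGroup (Fin r) | len w ≤ m + 1})
    (fun p => FreeGroup.mk (p.2.toWord ++ [(e p.2, p.1)])) ?_ ?_ (finite_ball _)
  · rw [Set.ncard_prod] at key
    simpa [Set.ncard_univ] using key
  · rintro ⟨s, w⟩ ⟨-, hw⟩
    simp only [Set.mem_setOf_eq, len] at hw ⊢
    rw [toWord_mk_of_reduced (he w s)]
    simpa using hw
  · rintro ⟨s, w⟩ - ⟨s', w'⟩ - h
    have h2 := congrArg FreeGroup.toWord h
    simp only [] at h2
    rw [toWord_mk_of_reduced (he w s), toWord_mk_of_reduced (he w' s')] at h2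
    have h3 := List.append_inj' h2 rfl
    have h4 := FreeGroup.toWord_injective h3.1
    subst h4
    simpa using h3.2

theorem pow_mul_ball (hr : 2 ≤ r) (m d : ℕ) :
    2 ^ d * {w : FreeGroup (Fin r) | len w ≤ m}.ncard
      ≤ {w : FreeGroup (Fin r) | len w ≤ m + d}.ncard := by
  induction d with
  | zero => simp
  | succ d ih =>
    have := two_mul_ball hr (m + d)
    rw [← add_assoc]
    calc _ = 2 * (2 ^ d * {w : FreeGroup (Fin r) | len w ≤ m}.ncard) := by ring
      _ ≤ _ := by omega

/-- If the conjugator is short, then the middle third survives. -/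
theorem middle_infix {α : Type*} (u c v : List α) (huv : v.length = u.length)
    (hu : u.length ≤ ((u ++ c ++ v).length + 2) / 3) :
    middleThird (u ++ c ++ v) <:+: c := by
  unfold middleThird
  set k := ((u ++ c ++ v).length + 2) / 3 with hk
  have hl : (u ++ c ++ v).length = u.length + c.length + u.length := by
    simp [huv, add_assoc]
  rw [hl]
  obtain ⟨d, hd⟩ := Nat.exists_eq_add_of_le hu
  rw [hd, List.append_assoc, List.drop_length_add_append, List.drop_append]
  rw [List.take_append_of_le_length]
  · exact (List.take_prefix _ _).isInfix.trans (List.drop_suffix _ _).isInfix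
  · simp; omega

theorem tail_eq {α : Type*} (u c : List (α × Bool)) (k : ℕ) (hk : k ≤ u.length) :
    (u ++ c ++ FreeGroup.invRev u).drop ((u ++ c ++ FreeGroup.invRev u).length - k)
      = FreeGroup.invRev ((u ++ c ++ FreeGroup.invRev u).take k) := by
  have h1 : (u ++ c ++ FreeGroup.invRev u).take k = u.take k := by
    rw [List.append_assoc, List.take_append_of_le_length hk]
  rw [h1]
  have h2 : u ++ c ++ FreeGroup.invRev u
      = (u ++ c ++ FreeGroup.invRev (u.drop k)) ++ FreeGroup.invRev (u.take k) := by
    conv_lhs => rw [← List.take_append_drop k u, FreeGroup.invRev_append]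
    simp
  rw [h2]
  apply List.drop_left'
  simp [FreeGroup.invRev_length]
  omega

/-- The good set. -/
def goodSet (r : ℕ) : Set (FreeGroup (Fin r)) :=
  {w : FreeGroup (Fin r) | 5 ≤ len w ∧
        ∃ c : FreeGroup (Fin r), IsCyclicReduction c w ∧
          middleThird (FreeGroup.toWord w) <:+: FreeGroup.toWord c}

theorem bad_tail (w : FreeGroup (Fin r)) (h5 : 5 ≤ len w) (hw : w ∉ goodSet r) :
    w.toWord.drop (len w - (len w + 2) / 3)
      = FreeGroup.invRev (w.toWord.take ((len w + 2) / 3)) := by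
  have hdec := FreeGroup.reduceCyclically.conj_conjugator_reduceCyclically w.toWord
  set u := FreeGroup.reduceCyclically.conjugator w.toWord with hu
  have hcr := FreeGroup.reduceCyclically.isCyclicallyReduced
    (FreeGroup.isReduced_toWord (x := w))
  set c := FreeGroup.reduceCyclically w.toWord with hc
  by_cases hk : u.length ≤ (len w + 2) / 3
  · exfalso
    apply hw
    have hcw := toWord_mk_of_reduced hcr.1
    refine ⟨h5, FreeGroup.mk c, ⟨?_, FreeGroup.mk u, ?_⟩, ?_⟩
    · intro a ha b hb hab
      rw [hcw] at ha hb
      have := hcr.2 b hb a ha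
      rw [hab] at this
      simp at this
    · rw [FreeGroup.inv_mk, FreeGroup.mul_mk, FreeGroup.mul_mk, hdec, FreeGroup.mk_toWord]
    · rw [hcw]
      have := middle_infix u c (FreeGroup.invRev u) FreeGroup.invRev_length
      rw [hdec] at this
      exact this hk
  · have := tail_eq u c ((len w + 2) / 3) (by omega)
    rw [hdec] at this
    exact this

theorem bad_count (n : ℕ) (hn : 6 ≤ n) :
    {w : FreeGroup (Fin r) | w ∉ goodSet r ∧ len w ≤ n}.ncard
      ≤ (n + 2) * {w : FreeGroup (Fin r) | len w ≤ 2 * n / 3}.ncard := by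
  set B := {w : FreeGroup (Fin r) | len w ≤ 2 * n / 3} with hB
  set T := {w : FreeGroup (Fin r) | (5 ≤ len w ∧ w ∉ goodSet r) ∧ len w ≤ n} with hT
  have hTfin : T.Finite := (finite_ball n).subset fun w hw => hw.2
  have hsub : {w : FreeGroup (Fin r) | w ∉ goodSet r ∧ len w ≤ n} ⊆ T ∪ B := by
    rintro w ⟨h1, h2⟩
    by_cases h : 5 ≤ len w
    · exact Or.inl ⟨⟨h, h1⟩, h2⟩
    · refine Or.inr ?_
      simp only [hB, Set.mem_setOf_eq]; omega
  have h1 := Set.ncard_le_ncard hsub (hTfin.union (finite_ball _))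
  have h2 := Set.ncard_union_le T B
  have key : T.ncard ≤ (Set.Iic n ×ˢ B).ncard := by
    have hlen : ∀ w : FreeGroup (Fin r), (FreeGroup.mk
        (w.toWord.take (len w - (len w + 2) / 3))).toWord
          = w.toWord.take (len w - (len w + 2) / 3) := fun w =>
      toWord_mk_of_reduced (FreeGroup.isReduced_toWord.infix (List.take_prefix _ _).isInfix)
    refine Set.ncard_le_ncard_of_injOn
      (fun w => (len w, FreeGroup.mk (w.toWord.take (len w - (len w + 2) / 3)))) ?_ ?_
      ((Set.finite_Iic n).prod (finite_ball _))
    · rintro w ⟨⟨h5, -⟩, hw⟩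
      refine ⟨hw, ?_⟩
      change List.length _ ≤ _
      simp only [hlen, List.length_take]
      omega
    · rintro w ⟨⟨h5, hw⟩, -⟩ w' ⟨⟨h5', hw'⟩, -⟩ h
      simp only [Prod.mk.injEq] at h
      obtain ⟨hl, h⟩ := h
      have h := congrArg FreeGroup.toWord h
      rw [hlen, hlen, ← hl] at h
      have t := bad_tail w h5 hw
      have t' := bad_tail w' h5' hw'
      rw [← hl] at t'
      apply FreeGroup.toWord_injective
      rw [← List.take_append_drop (len w - (len w + 2) / 3) w.toWord,
        ← List.take_append_drop (len w - (len w + 2) / 3) w'.toWord, t, t', h]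
      congr 2
      have := congrArg (List.take ((len w + 2) / 3)) h
      rw [List.take_take, List.take_take, min_eq_left (by omega)] at this
      exact this
  rw [Set.ncard_prod] at key
  have : (Set.Iic n).ncard = n + 1 := by
    rw [Set.ncard_eq_toFinset_card']; simp
  rw [this] at key
  calc _ ≤ _ := h1
    _ ≤ _ := h2
    _ ≤ (n + 1) * B.ncard + B.ncard := by omega
    _ = _ := by ring

theorem goodSet_expGeneric (hr : 2 ≤ r) :
    ExpGeneric (goodSet r) (Set.univ : Set (FreeGroup (Fin r))) := by
  refine ⟨0.1, by norm_num, Real.log 10, 6, fun n hn => ?_⟩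
  rw [ballCount_univ]
  have hbad := bad_count (r := r) n hn
  have hpow := pow_mul_ball hr (2 * n / 3) (n - 2 * n / 3)
  rw [Nat.add_sub_cancel' (by omega)] at hpow
  have hsum : {w : FreeGroup (Fin r) | len w ≤ n}.ncard
      ≤ ballCount (goodSet r) n + {w : FreeGroup (Fin r) | w ∉ goodSet r ∧ len w ≤ n}.ncard := by
    unfold ballCount
    refine le_trans (Set.ncard_le_ncard ?_ ?_) (Set.ncard_union_le _ _)
    · intro w hw
      by_cases h : w ∈ goodSet r
      · exact Or.inl ⟨h, hw⟩
      · exact Or.inr ⟨h, hw⟩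
    · exact ((finite_ball n).subset fun w hw => hw.2).union
        ((finite_ball n).subset fun w hw => hw.2)
  have hpos : 0 < {w : FreeGroup (Fin r) | len w ≤ n}.ncard := by
    rw [Set.ncard_pos (finite_ball n)]
    exact ⟨1, by simp [len]⟩
  set S := {w : FreeGroup (Fin r) | len w ≤ n}.ncard
  set M := {w : FreeGroup (Fin r) | len w ≤ 2 * n / 3}.ncard
  set D := {w : FreeGroup (Fin r) | w ∉ goodSet r ∧ len w ≤ n}.ncard
  set d := n - 2 * n / 3 with hd
  have hS : (0 : ℝ) < S := by exact_mod_cast hpos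
  rw [le_div_iff₀ hS]
  have hsum' : (S : ℝ) ≤ ballCount (goodSet r) n + D := by exact_mod_cast hsum
  have hbad' : (D : ℝ) ≤ (n + 2) * M := by exact_mod_cast hbad
  have hpow' : (2 : ℝ) ^ d * M ≤ S := by exact_mod_cast hpow
  have hdn : (n : ℝ) ≤ 3 * d := by
    have : n ≤ 3 * d := by omega
    exact_mod_cast this
  have hexp : Real.exp (0.2 * n) ≤ (2 : ℝ) ^ d := by
    have h2 : (2 : ℝ) ^ d = Real.exp (d * Real.log 2) := by
      rw [Real.exp_nat_mul, Real.exp_log (by norm_num)]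
    rw [h2, Real.exp_le_exp]
    have := Real.log_two_gt_d9
    nlinarith
  have hlin : (n : ℝ) + 2 ≤ 10 * Real.exp (0.1 * n) := by
    have := Real.add_one_le_exp (0.1 * (n : ℝ))
    linarith
  have hM : (0 : ℝ) ≤ M := Nat.cast_nonneg _
  have hE : Real.exp (Real.log 10 - 0.1 * n) * Real.exp (0.2 * n) = 10 * Real.exp (0.1 * n) := by
    rw [← Real.exp_add]
    conv_rhs => rw [← Real.exp_log (show (0 : ℝ) < 10 by norm_num), ← Real.exp_add]
    congr 1
    ring
  have hfin : (D : ℝ) ≤ Real.exp (Real.log 10 - 0.1 * n) * S := by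
    calc (D : ℝ) ≤ (n + 2) * M := hbad'
      _ ≤ (10 * Real.exp (0.1 * n)) * M := by gcongr
      _ = Real.exp (Real.log 10 - 0.1 * n) * (Real.exp (0.2 * n) * M) := by rw [← hE]; ring
      _ ≤ Real.exp (Real.log 10 - 0.1 * n) * (2 ^ d * M) := by gcongr
      _ ≤ _ := by gcongr
  linarith

/-- the set of elements of length at least 5 whose middle third survives
cyclic reduction (occurs as a contiguous sublist of the reduced word of the cyclic
reduction) is exponentially generic in `F`. -/
theorem middleThird_survives_expGeneric {r : ℕ} (hr : 2 ≤ r) :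
    ExpGeneric
      {w : FreeGroup (Fin r) | 5 ≤ len w ∧
        ∃ c : FreeGroup (Fin r), IsCyclicReduction c w ∧
          middleThird (FreeGroup.toWord w) <:+: FreeGroup.toWord c}
      (Set.univ : Set (FreeGroup (Fin r))) := by
  exact goodSet_expGeneric hr

end VG
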